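/- (λ-GRPO identity, Equation 11.) Letting t_max = max_{1≤i≤k} len(g_i) and λ^{(i,t)} = node(g_i.take(t+1)): ∑_{i=1}^k ∑_{t=0}^{len(g_i)−1} (P_{i,t}·a_i − D_{i,t})/|λ^{(i,t)}| = ∑_{t=0}^{t_max−1} ∑_{λ∈X_t} (F(p_{λ,t})·Â(λ) − H(p_{λ,t})), where p_{λ,t} denotes the common prefix g_i.take(t+1) shared by all i ∈ λ (well-defined for λ ∈ X_t). In particular, after scaling each token-level loss term by |λ^{(i,t)}|^{−1}, every process set contributes exactly once to the loss at each token index in its span. -/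

import Mathlib

/-- `nodeG g p` is the set of indices `i` such that `p` is a prefix of the trajectory `g i`. -/
noncomputable def nodeG {α : Type*} {k : ℕ} (g : Fin k → List α) (p : List α) :
    Finset (Fin k) :=
  @Finset.filter _ (fun i => p <+: g i) (Classical.decPred _) Finset.univ

/-- `BG g` is the family of process sets: nonempty sets of the form `nodeG g p`. -/
def BG {α : Type*} {k : ℕ} (g : Fin k → List α) : Set (Finset (Fin k)) :=
  {L | ∃ p : List α, (nodeG g p).Nonempty ∧ nodeG g p = L}

/-- `eG g L` is the length of the longest common prefix of the trajectories `g i`, `i ∈ L`. -/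
noncomputable def eG {α : Type*} {k : ℕ} (g : Fin k → List α) (L : Finset (Fin k)) : ℕ :=
  sSup {n : ℕ | ∃ p : List α, p.length = n ∧ ∀ i ∈ L, p <+: g i}

-- The immediate parent of a process set: its least strict superset in `BG g`.
open Classical in
noncomputable def parentG {α : Type*} {k : ℕ} (g : Fin k → List α) (L : Finset (Fin k)) :
    Finset (Fin k) :=
  if h : ∃ M, M ∈ BG g ∧ L ⊂ M ∧ ∀ M' ∈ BG g, L ⊂ M' → M ⊆ M' then h.choose
  else Finset.univ

/-- Start index of the process step of `L`: `0` for the root, `eG g (parentG g L)` otherwise. -/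
noncomputable def sG {α : Type*} {k : ℕ} (g : Fin k → List α) (L : Finset (Fin k)) : ℕ :=
  if L = Finset.univ then 0 else eG g (parentG g L)

/-- `XtG g t` is the family of process sets whose token span contains the index `t`. -/
noncomputable def XtG {α : Type*} {k : ℕ} (g : Fin k → List α) (t : ℕ) :
    Finset (Finset (Fin k)) :=
  @Finset.filter _ (fun L => L ∈ BG g ∧ sG g L ≤ t ∧ t < eG g L)
    (Classical.decPred _) Finset.univ

/-- Mean of the rewards. -/
noncomputable def rmeanG {k : ℕ} (r : Fin k → ℝ) : ℝ := (∑ i, r i) / k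

/-- Standard deviation of the rewards. -/
noncomputable def rstdG {k : ℕ} (r : Fin k → ℝ) : ℝ :=
  Real.sqrt ((∑ i, (r i - rmeanG r) ^ 2) / k)

/-- Outcome-level advantage `a_i`. -/
noncomputable def advG {k : ℕ} (r : Fin k → ℝ) (i : Fin k) : ℝ :=
  (r i - rmeanG r) / rstdG r

/-- Step-level reward `R̂(λ)`. -/
noncomputable def RhatG {k : ℕ} (r : Fin k → ℝ) (L : Finset (Fin k)) : ℝ :=
  (∑ i ∈ L, r i) / L.card

/-- Step-level advantage `Â(λ)`. -/
noncomputable def AhatG {k : ℕ} (r : Fin k → ℝ) (L : Finset (Fin k)) : ℝ :=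
  (RhatG r L - rmeanG r) / rstdG r

theorem mem_nodeG {α : Type*} {k : ℕ} {g : Fin k → List α} {p : List α} {i : Fin k} :
    i ∈ nodeG g p ↔ p <+: g i := by
  simp [nodeG]

theorem mem_XtG {α : Type*} {k : ℕ} {g : Fin k → List α} {t : ℕ} {L : Finset (Fin k)} :
    L ∈ XtG g t ↔ L ∈ BG g ∧ sG g L ≤ t ∧ t < eG g L := by
  simp [XtG]

theorem nodeG_nil {α : Type*} {k : ℕ} (g : Fin k → List α) : nodeG g [] = Finset.univ := by
  ext i
  simp [mem_nodeG]

theorem nodeG_anti {α : Type*} {k : ℕ} (g : Fin k → List α) {p q : List α} (h : p <+: q) :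
    nodeG g q ⊆ nodeG g p := fun _ hi =>
  mem_nodeG.2 (h.trans (mem_nodeG.1 hi))

theorem nodeG_mem_BG {α : Type*} {k : ℕ} {g : Fin k → List α} {p : List α} {i : Fin k}
    (h : p <+: g i) : nodeG g p ∈ BG g :=
  ⟨p, ⟨i, mem_nodeG.2 h⟩, rfl⟩

theorem nonempty_of_mem_BG {α : Type*} {k : ℕ} {g : Fin k → List α} {L : Finset (Fin k)}
    (hL : L ∈ BG g) : L.Nonempty := by
  obtain ⟨p, hp, rfl⟩ := hL
  exact hp

/-- Two process sets with a common element are nested. -/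
theorem BG_nested {α : Type*} {k : ℕ} {g : Fin k → List α} {M N : Finset (Fin k)}
    (hM : M ∈ BG g) (hN : N ∈ BG g) {i : Fin k} (hiM : i ∈ M) (hiN : i ∈ N) :
    M ⊆ N ∨ N ⊆ M := by
  obtain ⟨p, -, rfl⟩ := hM
  obtain ⟨q, -, rfl⟩ := hN
  exact (List.prefix_or_prefix_of_prefix (mem_nodeG.1 hiM) (mem_nodeG.1 hiN)).symm.imp
    (nodeG_anti g) (nodeG_anti g)

/-- Every process set other than the root has a least strict superset among process sets. -/
theorem parentG_spec {α : Type*} {k : ℕ} {g : Fin k → List α} {L : Finset (Fin k)}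
    (hL : L ∈ BG g) (hroot : L ≠ Finset.univ) :
    L ⊂ parentG g L ∧ ∀ M ∈ BG g, L ⊂ M → parentG g L ⊆ M := by
  classical
  obtain ⟨i, hi⟩ := nonempty_of_mem_BG hL
  have huniv : (Finset.univ : Finset (Fin k)) ∈ BG g :=
    nodeG_nil g ▸ nodeG_mem_BG (List.nil_prefix (l := g i))
  obtain ⟨M, hM, hmin⟩ := Finset.exists_min_image
    (Finset.univ.filter fun M => M ∈ BG g ∧ L ⊂ M) Finset.card
    ⟨Finset.univ, by simp [huniv, Finset.ssubset_univ_iff, hroot]⟩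
  simp only [Finset.mem_filter, Finset.mem_univ, true_and] at hM hmin
  have hex : ∃ M, M ∈ BG g ∧ L ⊂ M ∧ ∀ M' ∈ BG g, L ⊂ M' → M ⊆ M' := by
    refine ⟨M, hM.1, hM.2, fun N hN hLN => ?_⟩
    rcases BG_nested hM.1 hN (hM.2.subset hi) (hLN.subset hi) with h | h
    · exact h
    · exact (Finset.eq_of_subset_of_card_le h (hmin N ⟨hN, hLN⟩)).ge
  rw [parentG, dif_pos hex]
  exact hex.choose_spec.2

/-- A nonempty set has a common prefix of length greater than `t` iff all its members share
their first `t + 1` tokens. -/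
theorem lt_eG_iff {α : Type*} {k : ℕ} {g : Fin k → List α} {L : Finset (Fin k)} {i : Fin k}
    (hi : i ∈ L) {t : ℕ} :
    t < eG g L ↔ t < (g i).length ∧ L ⊆ nodeG g ((g i).take (t + 1)) := by
  have hbdd : BddAbove {n : ℕ | ∃ p : List α, p.length = n ∧ ∀ j ∈ L, p <+: g j} := by
    refine ⟨(g i).length, ?_⟩
    rintro n ⟨p, rfl, hp⟩
    exact (hp i hi).length_le
  constructor
  · intro h
    obtain ⟨p, hlen, hp⟩ := Nat.sSup_mem
      (s := {n : ℕ | ∃ p : List α, p.length = n ∧ ∀ j ∈ L, p <+: g j})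
      ⟨0, [], rfl, fun _ _ => List.nil_prefix⟩ hbdd
    change p.length = eG g L at hlen
    have hle := (hp i hi).length_le
    refine ⟨by omega, fun j hj => mem_nodeG.2 (List.IsPrefix.trans ?_ (hp j hj))⟩
    refine List.prefix_of_prefix_length_le (List.take_prefix _ _) (hp i hi) ?_
    rw [List.length_take]
    omega
  · rintro ⟨hlt, hsub⟩
    refine Nat.lt_of_succ_le (le_csSup hbdd ⟨(g i).take (t + 1), ?_, fun j hj =>
      mem_nodeG.1 (hsub hj)⟩)
    rw [List.length_take]
    omega

/-- The process sets whose span contains `t` are the nodes of the prefixes of length `t + 1`. -/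
theorem mem_XtG_iff {α : Type*} {k : ℕ} {g : Fin k → List α} {t : ℕ} {L : Finset (Fin k)}
    {i : Fin k} (hi : i ∈ L) :
    L ∈ XtG g t ↔ t < (g i).length ∧ nodeG g ((g i).take (t + 1)) = L := by
  rw [mem_XtG, lt_eG_iff hi]
  constructor
  · rintro ⟨hB, hs, hlt, hsub⟩
    refine ⟨hlt, ?_⟩
    by_contra hne
    have hss : L ⊂ nodeG g ((g i).take (t + 1)) := hsub.ssubset_of_ne (Ne.symm hne)
    have hroot : L ≠ Finset.univ := (Finset.ssubset_univ_iff.1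
      (hss.trans_subset (Finset.subset_univ _)))
    obtain ⟨hpar, hleast⟩ := parentG_spec hB hroot
    rw [sG, if_neg hroot] at hs
    exact hs.not_gt ((lt_eG_iff (hpar.subset hi)).2
      ⟨hlt, hleast _ (nodeG_mem_BG (List.take_prefix _ _)) hss⟩)
  · rintro ⟨hlt, hL⟩
    have hB : L ∈ BG g := hL ▸ nodeG_mem_BG (List.take_prefix _ _)
    refine ⟨hB, ?_, hlt, hL.ge⟩
    rw [sG]
    split_ifs with hroot
    · exact Nat.zero_le t
    · have hpar := (parentG_spec hB hroot).1
      by_contra! h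
      exact hpar.not_subset (hL ▸ ((lt_eG_iff (hpar.subset hi)).1 h).2)

/-- Averaging the outcome-level losses over a process set gives its step-level loss. -/
theorem sum_loss_div_card {k : ℕ} (r : Fin k → ℝ) {L : Finset (Fin k)} (hL : L.Nonempty)
    (a b : ℝ) :
    ∑ i ∈ L, (a * advG r i - b) / (L.card : ℝ) = a * AhatG r L - b := by
  have hc : (L.card : ℝ) ≠ 0 := Nat.cast_ne_zero.2 hL.card_ne_zero
  rw [← Finset.sum_div, Finset.sum_sub_distrib, ← Finset.mul_sum]
  simp only [advG, AhatG, RhatG, ← Finset.sum_div, Finset.sum_sub_distrib, Finset.sum_const,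
    nsmul_eq_mul]
  field_simp

/-- **λ-GRPO identity (Equation 11).** With `t_max = max_i len(gᵢ)`,
`λ^{(i,t)} = node (gᵢ.take (t+1))`, and `p L t` the common prefix `gᵢ.take (t+1)` shared by
all `i ∈ L` (well-defined for `L ∈ X_t`): after scaling each token-level loss term by
`|λ^{(i,t)}|⁻¹`, every process set contributes exactly once to the loss at each token index
in its span. -/
theorem lambda_grpo_identity {α : Type*} {k : ℕ} (hk : 1 ≤ k)
    (g : Fin k → List α) (r : Fin k → ℝ) (hstd : 0 < rstdG r)
    (F H : List α → ℝ)
    (p : Finset (Fin k) → ℕ → List α)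
    (hp : ∀ t : ℕ, ∀ L ∈ XtG g t, ∀ i ∈ L, (g i).take (t + 1) = p L t) :
    ∑ i, ∑ t ∈ Finset.range (g i).length,
        (F ((g i).take (t + 1)) * advG r i - H ((g i).take (t + 1))) /
          ((nodeG g ((g i).take (t + 1))).card : ℝ) =
      ∑ t ∈ Finset.range (Finset.univ.sup fun i => (g i).length),
        ∑ L ∈ XtG g t, (F (p L t) * AhatG r L - H (p L t)) := by
  classical
  rw [Finset.sum_comm' (t' := Finset.range (Finset.univ.sup fun i => (g i).length))
    (s' := fun t => Finset.univ.filter fun i => t < (g i).length)]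
  · refine Finset.sum_congr rfl fun t _ => ?_
    rw [← Finset.sum_fiberwise_of_maps_to (t := XtG g t)
      (g := fun i => nodeG g ((g i).take (t + 1)))]
    · refine Finset.sum_congr rfl fun L hL => ?_
      have hne := nonempty_of_mem_BG (mem_XtG.1 hL).1
      have hfiber : (Finset.univ.filter fun i => t < (g i).length).filter
          (fun i => nodeG g ((g i).take (t + 1)) = L) = L := by
        ext i
        simp only [Finset.mem_filter, Finset.mem_univ, true_and]
        refine ⟨?_, fun hi => (mem_XtG_iff hi).1 hL⟩
        rintro ⟨-, rfl⟩
        exact mem_nodeG.2 (List.take_prefix _ _)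
      rw [hfiber, ← sum_loss_div_card r hne]
      refine Finset.sum_congr rfl fun i hi => ?_
      rw [((mem_XtG_iff hi).1 hL).2, hp t L hL i hi]
    · intro i hi
      exact (mem_XtG_iff (mem_nodeG.2 (List.take_prefix _ _))).2
        ⟨(Finset.mem_filter.1 hi).2, rfl⟩
  · intro i t
    simp only [Finset.mem_univ, true_and, Finset.mem_range, Finset.mem_filter]
    exact ⟨fun h => ⟨h, h.trans_le
      (Finset.le_sup (f := fun i => (g i).length) (Finset.mem_univ i))⟩, fun h => h.1⟩
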